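/- arXiv:2207.10825 — 3 statements merged into one kernel-verified Lean document; each statement's English description precedes it below -/
import Mathlib

section
/- Let σ > 0, β ∈ (0, 360), and ρ ∈ (0, 1). Let C = ∫_{-180}^{180} exp(-t²/(2σ²)) dt, and define the truncated-Gaussian densities D(x) = exp(-x²/(2σ²))/C for x ∈ [-180, 180] and D_b(x) = exp(-(x-β)²/(2σ²))/C for x ∈ [β-180, β+180]. Define the attack-success-rate bound ASR(x) = ρ·D_b(x) / ((1-ρ)·D(x) + ρ·D_b(x)) for x in the common support [β-180, 180]. Then ASR attains its maximum over [β-180, 180] at x = 180°, i.e., for every x ∈ [β-180, 180], ASR(x) ≤ ASR(180). -/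
/-- The attack-success-rate bound
`ASR(x) = ρ·D_b(x) / ((1-ρ)·D(x) + ρ·D_b(x))` of the optimal classifier,
with clean density `D` = N(0,σ²) truncated to [-180,180] and poisoned density
`D_b` = N(β,σ²) truncated to [β-180,β+180] (common normalizing constant `C`),
attains its maximum over the common support `[β-180, 180]` at `x = 180`. -/
theorem asr_maximized_at_180
    (σ β ρ : ℝ) (hσ : 0 < σ) (hβ : β ∈ Set.Ioo (0 : ℝ) 360)
    (hρ : ρ ∈ Set.Ioo (0 : ℝ) 1)
    (C : ℝ) (hC : C = ∫ t in (-180 : ℝ)..180, Real.exp (-t ^ 2 / (2 * σ ^ 2)))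
    (D Db ASR : ℝ → ℝ)
    (hD : ∀ x, D x = Real.exp (-x ^ 2 / (2 * σ ^ 2)) / C)
    (hDb : ∀ x, Db x = Real.exp (-(x - β) ^ 2 / (2 * σ ^ 2)) / C)
    (hASR : ∀ x, ASR x = ρ * Db x / ((1 - ρ) * D x + ρ * Db x)) :
    ∀ x ∈ Set.Icc (β - 180) (180 : ℝ), ASR x ≤ ASR 180 := by
  obtain ⟨hβ0, -⟩ := hβ
  obtain ⟨hρ0, hρ1⟩ := hρ
  have hCpos : 0 < C := by
    rw [hC]
    refine intervalIntegral.intervalIntegral_pos_of_pos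
      (Continuous.intervalIntegrable (by fun_prop) _ _) (fun t => Real.exp_pos _) (by norm_num)
  have hDpos : ∀ x, 0 < D x := fun x => by rw [hD]; positivity
  have hDbpos : ∀ x, 0 < Db x := fun x => by rw [hDb]; positivity
  rintro x ⟨-, hx⟩
  have likelihood_ratio : Db x * D 180 ≤ Db 180 * D x := by
    simp only [hD, hDb, div_mul_div_comm, ← Real.exp_add, ← add_div]
    gcongr ?_ / _
    refine Real.exp_le_exp.mpr ?_
    gcongr ?_ / _
    nlinarith [mul_nonneg hβ0.le (sub_nonneg.mpr hx)]
  have hden : ∀ y, 0 < (1 - ρ) * D y + ρ * Db y := fun y =>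
    add_pos (mul_pos (sub_pos.mpr hρ1) (hDpos y)) (mul_pos hρ0 (hDbpos y))
  rw [hASR, hASR, div_le_div_iff₀ (hden x) (hden 180)]
  have hscaled := mul_le_mul_of_nonneg_left likelihood_ratio
    (mul_pos hρ0 (sub_pos.mpr hρ1)).le
  linarith
end

section
/- Let σ > 0, β ∈ (0, 360), and ρ ∈ (0, 1). With D(x) = exp(-x²/(2σ²))/C and D_b(x) = exp(-(x-β)²/(2σ²))/C for the common normalizing constant C = ∫_{-180}^{180} exp(-t²/(2σ²)) dt, the function ASR(x) = ρ·D_b(x) / ((1-ρ)·D(x) + ρ·D_b(x)) is strictly monotonically increasing on the interval [β-180, 180]. -/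
/-- The attack-success-rate bound
`ASR(x) = ρ·D_b(x) / ((1-ρ)·D(x) + ρ·D_b(x))` is strictly monotonically
increasing on the interval `[β-180, 180]`. -/
theorem asr_strictMonoOn
    (σ β ρ : ℝ) (hσ : 0 < σ) (hβ : β ∈ Set.Ioo (0 : ℝ) 360)
    (hρ : ρ ∈ Set.Ioo (0 : ℝ) 1)
    (C : ℝ) (hC : C = ∫ t in (-180 : ℝ)..180, Real.exp (-t ^ 2 / (2 * σ ^ 2)))
    (D Db ASR : ℝ → ℝ)
    (hD : ∀ x, D x = Real.exp (-x ^ 2 / (2 * σ ^ 2)) / C)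
    (hDb : ∀ x, Db x = Real.exp (-(x - β) ^ 2 / (2 * σ ^ 2)) / C)
    (hASR : ∀ x, ASR x = ρ * Db x / ((1 - ρ) * D x + ρ * Db x)) :
    StrictMonoOn ASR (Set.Icc (β - 180) (180 : ℝ)) := by
  obtain ⟨hβ0, -⟩ := hβ
  obtain ⟨hρ0, hρ1⟩ := hρ
  have hρ1' : 0 < 1 - ρ := sub_pos.mpr hρ1
  have hCpos : 0 < C := by
    rw [hC]
    refine intervalIntegral.intervalIntegral_pos_of_pos ?_ (fun t => Real.exp_pos _) (by norm_num)
    exact Continuous.intervalIntegrable (by fun_prop) _ _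
  have hDpos : ∀ x, 0 < D x := fun x => by rw [hD]; positivity
  have hDbpos : ∀ x, 0 < Db x := fun x => by rw [hDb]; positivity
  intro x _ y _ hxy
  have ratio_lt : Db x * D y < Db y * D x := by
    rw [hD, hD, hDb, hDb, div_mul_div_comm, div_mul_div_comm, ← Real.exp_add, ← Real.exp_add,
      ← add_div, ← add_div]
    gcongr ?_ / _
    apply Real.exp_lt_exp.mpr
    gcongr ?_ / _
    nlinarith [mul_lt_mul_of_pos_left hxy hβ0]
  have hx := hDpos x
  have hy := hDpos y
  have hbx := hDbpos x
  have hby := hDbpos y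
  rw [hASR, hASR, div_lt_div_iff₀ (by positivity) (by positivity)]
  linear_combination ρ * (1 - ρ) * ratio_lt
end

section
/- Let σ > 0, β ∈ (0, 180), and ρ ∈ (0, 1). With D(x) = exp(-x²/(2σ²))/C and D_b(x) = exp(-(x-β)²/(2σ²))/C where C = ∫_{-180}^{180} exp(-t²/(2σ²)) dt, define ASR(x) = ρ·D_b(x) / ((1-ρ)·D(x) + ρ·D_b(x)). Then for every test-time angle x with β < x ≤ 180, one has ASR(x) > ASR(β); in particular the attack success rate bound at the training-time backdoor angle β is not maximal, and every strictly larger admissible angle yields a strictly larger bound. -/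
/-- For `β ∈ (0,180)`, every admissible test-time angle
`x` with `β < x ≤ 180` yields a strictly larger attack-success-rate bound than
the training-time backdoor angle: `ASR(x) > ASR(β)`. -/
theorem asr_strictly_larger_above_backdoor_angle
    (σ β ρ : ℝ) (hσ : 0 < σ) (hβ : β ∈ Set.Ioo (0 : ℝ) 180)
    (hρ : ρ ∈ Set.Ioo (0 : ℝ) 1)
    (C : ℝ) (hC : C = ∫ t in (-180 : ℝ)..180, Real.exp (-t ^ 2 / (2 * σ ^ 2)))
    (D Db ASR : ℝ → ℝ)
    (hD : ∀ x, D x = Real.exp (-x ^ 2 / (2 * σ ^ 2)) / C)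
    (hDb : ∀ x, Db x = Real.exp (-(x - β) ^ 2 / (2 * σ ^ 2)) / C)
    (hASR : ∀ x, ASR x = ρ * Db x / ((1 - ρ) * D x + ρ * Db x)) :
    ∀ x : ℝ, β < x → x ≤ 180 → ASR β < ASR x := by
  intro x hx _
  obtain ⟨hβ₀, -⟩ := hβ
  obtain ⟨hρ₀, hρ₁⟩ := hρ
  have hCpos : 0 < C := by
    rw [hC]
    exact intervalIntegral.intervalIntegral_pos_of_pos
      (Continuous.intervalIntegrable (by fun_prop) _ _) (fun t => Real.exp_pos _) (by norm_num)
  have hDpos : ∀ y, 0 < D y := fun y => by rw [hD]; positivity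
  have hDbpos : ∀ y, 0 < Db y := fun y => by rw [hDb]; positivity
  have hratio : Db β * D x < Db x * D β := by
    simp only [hD, hDb, div_mul_div_comm, ← Real.exp_add, ← add_div]
    refine div_lt_div_of_pos_right (Real.exp_lt_exp.2 ?_) (mul_pos hCpos hCpos)
    refine div_lt_div_of_pos_right ?_ (by positivity)
    nlinarith [mul_pos hβ₀ (sub_pos.2 hx)]
  have hden : ∀ y, 0 < (1 - ρ) * D y + ρ * Db y := fun y =>
    add_pos (mul_pos (sub_pos.2 hρ₁) (hDpos y)) (mul_pos hρ₀ (hDbpos y))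
  rw [hASR, hASR, div_lt_div_iff₀ (hden β) (hden x)]
  linarith [mul_lt_mul_of_pos_left hratio (mul_pos hρ₀ (sub_pos.2 hρ₁))]
end
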